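/- Let $p > 1/2$, $q = 1-p$, and consider the asymmetric exclusion process on $\mathbb{Z}$ with rates $q_e(x,x+1)=p$, $q_e(x,x-1)=q$, together with birth rate $\beta > 0$ and death rate $\delta > 0$ at a single site $z$ and no births/deaths elsewhere. Let $\pi(x) = (p/q)^x$ and choose $c > 0$ with $c\pi(z)/(1+c\pi(z)) = \beta/(\beta+\delta)$. Then the product measure $\nu^c$ on $\{0,1\}^{\mathbb{Z}}$ with marginals $\nu^c\{\eta(x)=1\} = c\pi(x)/(1+c\pi(x))$ is invariant (indeed reversible) for this process, and the product measure $\nu_\rho$ with constant density $\rho = \beta/(\beta+\delta)$ is also invariant; since $\nu^c \ne \nu_\rho$, the process is not ergodic. -/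

import Mathlib

open MeasureTheory Filter
open scoped Classical

/-- Exchange the values of a configuration at two sites. -/
def swapSites (η : ℤ → Bool) (x y : ℤ) : ℤ → Bool :=
  fun u => if u = x then η y else if u = y then η x else η u

/-- Flip the value of a configuration at a site. -/
def flipSite (η : ℤ → Bool) (x : ℤ) : ℤ → Bool :=
  fun u => if u = x then !(η u) else η u

/-- A function of the configuration depending on finitely many coordinates. -/
def IsCylinder (f : (ℤ → Bool) → ℝ) : Prop :=
  ∃ F : Finset ℤ, ∀ η η' : ℤ → Bool, (∀ x ∈ F, η x = η' x) → f η = f η'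

/-- Generator of the nearest-neighbor asymmetric exclusion process on `ℤ` with jump
rates `p` to the right, `q` to the left, and a birth-death mechanism with rates
`β` (0→1) and `δ` (1→0) at the single site `z`. -/
noncomputable def noisyASEPGen (p q β δ : ℝ) (z : ℤ)
    (f : (ℤ → Bool) → ℝ) (η : ℤ → Bool) : ℝ :=
  (∑' x : ℤ,
    ((if η x = true ∧ η (x + 1) = false then p else 0) *
        (f (swapSites η x (x + 1)) - f η) +
      (if η x = true ∧ η (x - 1) = false then q else 0) *
        (f (swapSites η x (x - 1)) - f η))) +
  (if η z then δ else β) * (f (flipSite η z) - f η)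

/-- `ν` is the product (Bernoulli) measure with density profile `r`. -/
def IsProductWith (ν : Measure (ℤ → Bool)) (r : ℤ → ℝ) : Prop :=
  ∀ F : Finset ℤ, ∀ b : ℤ → Bool,
    (ν {η | ∀ x ∈ F, η x = b x}).toReal = ∏ x ∈ F, (if b x then r x else 1 - r x)

/-- Invariance of a measure for the noisy ASEP: the generator integrates to zero against
all cylinder functions. -/
def IsInvariantForNoisyASEP (p q β δ : ℝ) (z : ℤ) (ν : Measure (ℤ → Bool)) : Prop :=
  ∀ f : (ℤ → Bool) → ℝ, IsCylinder f → ∫ η, noisyASEPGen p q β δ z f η ∂ν = 0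

theorem IsCylinder.add {f g : (ℤ → Bool) → ℝ} (hf : IsCylinder f) (hg : IsCylinder g) :
    IsCylinder (fun η => f η + g η) := by
  obtain ⟨F, hF⟩ := hf
  obtain ⟨G, hG⟩ := hg
  refine ⟨F ∪ G, fun η η' h => ?_⟩
  simp only [hF η η' fun x hx => h x (Finset.mem_union_left _ hx),
    hG η η' fun x hx => h x (Finset.mem_union_right _ hx)]

theorem IsCylinder.mul {f g : (ℤ → Bool) → ℝ} (hf : IsCylinder f) (hg : IsCylinder g) :
    IsCylinder (fun η => f η * g η) := by
  obtain ⟨F, hF⟩ := hf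
  obtain ⟨G, hG⟩ := hg
  refine ⟨F ∪ G, fun η η' h => ?_⟩
  simp only [hF η η' fun x hx => h x (Finset.mem_union_left _ hx),
    hG η η' fun x hx => h x (Finset.mem_union_right _ hx)]

theorem IsCylinder.sub {f g : (ℤ → Bool) → ℝ} (hf : IsCylinder f) (hg : IsCylinder g) :
    IsCylinder (fun η => f η - g η) := by
  obtain ⟨F, hF⟩ := hf
  obtain ⟨G, hG⟩ := hg
  refine ⟨F ∪ G, fun η η' h => ?_⟩
  simp only [hF η η' fun x hx => h x (Finset.mem_union_left _ hx),
    hG η η' fun x hx => h x (Finset.mem_union_right _ hx)]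

theorem isCylinder_const (a : ℝ) : IsCylinder (fun _ => a) := ⟨∅, fun _ _ _ => rfl⟩

theorem isCylinder_apply (g : Bool → ℝ) (x : ℤ) : IsCylinder (fun η => g (η x)) :=
  ⟨{x}, fun η η' h => by simp only [h x (Finset.mem_singleton_self x)]⟩

theorem isCylinder_apply_apply (g : Bool → Bool → ℝ) (x y : ℤ) :
    IsCylinder (fun η => g (η x) (η y)) :=
  ⟨{x, y}, fun η η' h => by simp only [h x (by simp), h y (by simp)]⟩

theorem IsCylinder.comp_swapSites {f : (ℤ → Bool) → ℝ} (hf : IsCylinder f) (x y : ℤ) :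
    IsCylinder (fun η => f (swapSites η x y)) := by
  obtain ⟨F, hF⟩ := hf
  refine ⟨insert x (insert y F), fun η η' h => hF _ _ fun u hu => ?_⟩
  simp only [swapSites, h x (by simp), h y (by simp), h u (by simp [hu])]

theorem IsCylinder.comp_flipSite {f : (ℤ → Bool) → ℝ} (hf : IsCylinder f) (x : ℤ) :
    IsCylinder (fun η => f (flipSite η x)) := by
  obtain ⟨F, hF⟩ := hf
  refine ⟨F, fun η η' h => hF _ _ fun u hu => ?_⟩
  simp only [flipSite, h u hu]

theorem IsCylinder.comp_update {f : (ℤ → Bool) → ℝ} (hf : IsCylinder f) (x : ℤ) (b : Bool) :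
    IsCylinder (fun η => f (Function.update η x b)) := by
  obtain ⟨F, hF⟩ := hf
  refine ⟨F, fun η η' h => hF _ _ fun u hu => ?_⟩
  simp only [Function.update_apply, h u hu]

/-- The configuration whose set of occupied sites is `A`. -/
noncomputable def occupied (A : Finset ℤ) : ℤ → Bool := fun x => decide (x ∈ A)

theorem measurableSet_cylinderEvent (F : Finset ℤ) (b : ℤ → Bool) :
    MeasurableSet {η : ℤ → Bool | ∀ x ∈ F, η x = b x} := by
  have : {η : ℤ → Bool | ∀ x ∈ F, η x = b x} = ⋂ x ∈ F, (fun η => η x) ⁻¹' {b x} := by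
    ext η; simp
  rw [this]
  exact Finset.measurableSet_biInter F fun x _ =>
    measurable_pi_apply x (MeasurableSet.singleton (b x))

theorem eq_sum_indicator {f : (ℤ → Bool) → ℝ} {F : Finset ℤ}
    (hF : ∀ η η' : ℤ → Bool, (∀ x ∈ F, η x = η' x) → f η = f η') :
    f = fun η => ∑ A ∈ F.powerset,
      Set.indicator {η : ℤ → Bool | ∀ x ∈ F, η x = occupied A x}
        (fun _ => f (occupied A)) η := by
  funext η
  have hη : ∀ x ∈ F, η x = occupied (F.filter fun x => η x = true) x := by
    intro x hx
    cases h : η x <;> simp [occupied, h, hx]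
  rw [Finset.sum_eq_single (F.filter fun x => η x = true)]
  · rw [Set.indicator_of_mem (by exact hη)]
    exact hF _ _ hη
  · intro A hA hne
    refine Set.indicator_of_notMem (fun hmem => hne ?_) _
    ext x
    have hAF := Finset.mem_powerset.1 hA
    constructor
    · intro hx
      have := hmem x (hAF hx)
      simp [occupied, hx] at this
      simp [hAF hx, this]
    · intro hx
      obtain ⟨hxF, hx1⟩ := Finset.mem_filter.1 hx
      have := hmem x hxF
      simpa [occupied, hx1] using this
  · intro h
    exact absurd (Finset.mem_powerset.2 (Finset.filter_subset _ _)) h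

theorem IsCylinder.integrable {f : (ℤ → Bool) → ℝ} (hf : IsCylinder f)
    (ν : Measure (ℤ → Bool)) [IsProbabilityMeasure ν] : Integrable f ν := by
  obtain ⟨F, hF⟩ := hf
  rw [eq_sum_indicator hF]
  exact integrable_finsetSum _ fun A _ =>
    (integrable_const _).indicator (measurableSet_cylinderEvent _ _)

/-- The profile of a product measure is determined by the measure. -/
theorem IsProductWith.profile_eq {ν : Measure (ℤ → Bool)} {r s : ℤ → ℝ}
    (hr : IsProductWith ν r) (hs : IsProductWith ν s) : r = s := by
  funext x
  simpa using (hr {x} fun _ => true).symm.trans (hs {x} fun _ => true)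

namespace IsProductWith

variable {ν : Measure (ℤ → Bool)} [IsProbabilityMeasure ν] {r : ℤ → ℝ}

theorem integral_eq_sum (hν : IsProductWith ν r) {f : (ℤ → Bool) → ℝ} {F : Finset ℤ}
    (hF : ∀ η η' : ℤ → Bool, (∀ x ∈ F, η x = η' x) → f η = f η') :
    ∫ η, f η ∂ν = ∑ A ∈ F.powerset,
      (∏ x ∈ F, if occupied A x then r x else 1 - r x) * f (occupied A) := by
  conv_lhs => rw [eq_sum_indicator hF]
  rw [integral_finsetSum _ fun A _ =>
    (integrable_const _).indicator (measurableSet_cylinderEvent _ _)]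
  refine Finset.sum_congr rfl fun A _ => ?_
  rw [integral_indicator_const _ (measurableSet_cylinderEvent _ _), smul_eq_mul, Measure.real,
    hν F (occupied A)]

/-- Averaging over the value at a single site does not change the integral. -/
theorem integral_eq_integral_update (hν : IsProductWith ν r) {f : (ℤ → Bool) → ℝ}
    (hf : IsCylinder f) (z : ℤ) :
    ∫ η, f η ∂ν = ∫ η, (r z * f (Function.update η z true) +
      (1 - r z) * f (Function.update η z false)) ∂ν := by
  obtain ⟨F, hF⟩ := hf
  have hzF : z ∉ F.erase z := Finset.notMem_erase z F
  have hF₁ : ∀ η η' : ℤ → Bool, (∀ x ∈ insert z (F.erase z), η x = η' x) → f η = f η' :=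
    fun η η' h => hF η η' fun x hx => h x (by
      by_cases hxz : x = z <;> simp [hxz, hx])
  have hF₂ : ∀ b, ∀ η η' : ℤ → Bool, (∀ x ∈ F.erase z, η x = η' x) →
      f (Function.update η z b) = f (Function.update η' z b) := by
    intro b η η' h
    refine hF _ _ fun x hx => ?_
    by_cases hxz : x = z
    · simp [hxz]
    · simp [hxz, h x (Finset.mem_erase.2 ⟨hxz, hx⟩)]
  rw [hν.integral_eq_sum hF₁, hν.integral_eq_sum (F := F.erase z)
    (fun η η' h => by rw [hF₂ true η η' h, hF₂ false η η' h]), Finset.sum_powerset_insert hzF,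
    ← Finset.sum_add_distrib]
  refine Finset.sum_congr rfl fun A hA => ?_
  have hzA : z ∉ A := fun h => hzF (Finset.mem_powerset.1 hA h)
  have h₁ : occupied (insert z A) = Function.update (occupied A) z true := by
    funext x
    by_cases hxz : x = z <;> simp [occupied, hxz]
  have h₀ : Function.update (occupied A) z false = occupied A := by
    funext x
    by_cases hxz : x = z <;> simp [occupied, hxz, hzA]
  have h₂ : ∏ x ∈ F.erase z, (if occupied (insert z A) x then r x else 1 - r x) =
      ∏ x ∈ F.erase z, (if occupied A x then r x else 1 - r x) := by
    refine Finset.prod_congr rfl fun x hx => ?_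
    rw [h₁, Function.update_of_ne (Finset.ne_of_mem_erase hx)]
  rw [Finset.prod_insert hzF, Finset.prod_insert hzF, h₂, h₁, h₀]
  simp [occupied, hzA]
  ring

theorem integral_eq_integral_update_update (hν : IsProductWith ν r) {f : (ℤ → Bool) → ℝ}
    (hf : IsCylinder f) (x y : ℤ) :
    ∫ η, f η ∂ν = ∫ η,
      (r y * (r x * f (Function.update (Function.update η y true) x true) +
          (1 - r x) * f (Function.update (Function.update η y true) x false)) +
        (1 - r y) * (r x * f (Function.update (Function.update η y false) x true) +
          (1 - r x) * f (Function.update (Function.update η y false) x false))) ∂ν := by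
  rw [hν.integral_eq_integral_update hf x, hν.integral_eq_integral_update _ y]
  exact ((isCylinder_const _).mul (hf.comp_update x true)).add
    ((isCylinder_const _).mul (hf.comp_update x false))

end IsProductWith

/-- The birth-death part of the generator. -/
noncomputable def siteGen (β δ : ℝ) (z : ℤ) (f : (ℤ → Bool) → ℝ) (η : ℤ → Bool) : ℝ :=
  (if η z then δ else β) * (f (flipSite η z) - f η)

/-- The part of the generator exchanging particles along the bond `{x, x + 1}`. -/
noncomputable def bondGen (p q : ℝ) (x : ℤ) (f : (ℤ → Bool) → ℝ) (η : ℤ → Bool) : ℝ :=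
  (if η x = true ∧ η (x + 1) = false then p else 0) * (f (swapSites η x (x + 1)) - f η) +
  (if η (x + 1) = true ∧ η x = false then q else 0) * (f (swapSites η (x + 1) x) - f η)

theorem IsCylinder.siteGen {f : (ℤ → Bool) → ℝ} (hf : IsCylinder f) (β δ : ℝ) (z : ℤ) :
    IsCylinder (siteGen β δ z f) :=
  (isCylinder_apply (fun b => if b then δ else β) z).mul ((hf.comp_flipSite z).sub hf)

theorem IsCylinder.bondGen {f : (ℤ → Bool) → ℝ} (hf : IsCylinder f) (p q : ℝ) (x : ℤ) :
    IsCylinder (bondGen p q x f) :=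
  ((isCylinder_apply_apply (fun b b' => if b = true ∧ b' = false then p else 0) x (x + 1)).mul
      ((hf.comp_swapSites x (x + 1)).sub hf)).add
    ((isCylinder_apply_apply (fun b b' => if b = true ∧ b' = false then q else 0) (x + 1) x).mul
      ((hf.comp_swapSites (x + 1) x).sub hf))

theorem comp_swapSites_eq {f : (ℤ → Bool) → ℝ} {F : Finset ℤ}
    (hF : ∀ η η' : ℤ → Bool, (∀ x ∈ F, η x = η' x) → f η = f η') {x y : ℤ}
    (hx : x ∉ F) (hy : y ∉ F) (η : ℤ → Bool) : f (swapSites η x y) = f η := by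
  refine hF _ _ fun u hu => ?_
  have hux : u ≠ x := fun h => hx (h ▸ hu)
  have huy : u ≠ y := fun h => hy (h ▸ hu)
  simp [swapSites, hux, huy]

theorem noisyASEPGen_eq_sum (p q β δ : ℝ) (z : ℤ) {f : (ℤ → Bool) → ℝ} {F : Finset ℤ}
    (hF : ∀ η η' : ℤ → Bool, (∀ x ∈ F, η x = η' x) → f η = f η') {a b : ℤ}
    (hab : ∀ x ∈ F, a < x ∧ x < b) (η : ℤ → Bool) :
    noisyASEPGen p q β δ z f η =
      ∑ x ∈ Finset.Ico a b, bondGen p q x f η + siteGen β δ z f η := by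
  set R : ℤ → ℝ := fun x =>
    (if η x = true ∧ η (x + 1) = false then p else 0) * (f (swapSites η x (x + 1)) - f η)
  set L : ℤ → ℝ := fun x =>
    (if η x = true ∧ η (x - 1) = false then q else 0) * (f (swapSites η x (x - 1)) - f η)
  have hout : ∀ x ∉ Finset.Ico a b, x ∉ F ∧ x + 1 ∉ F := by
    intro x hx
    rw [Finset.mem_Ico] at hx
    exact ⟨fun h => hx (by have := hab _ h; omega), fun h => hx (by have := hab _ h; omega)⟩
  have hR : HasSum R (∑ x ∈ Finset.Ico a b, R x) := by
    refine hasSum_sum_of_ne_finset_zero fun x hx => ?_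
    simp only [R, comp_swapSites_eq hF (hout x hx).1 (hout x hx).2, sub_self, mul_zero]
  have hL : HasSum L (∑ x ∈ Finset.Ico a b, L (x + 1)) := by
    rw [← (Equiv.addRight (1 : ℤ)).hasSum_iff]
    refine hasSum_sum_of_ne_finset_zero fun x hx => ?_
    simp only [L, Function.comp, Equiv.coe_addRight, add_sub_cancel_right,
      comp_swapSites_eq hF (hout x hx).2 (hout x hx).1, sub_self, mul_zero]
  have h := (hR.add hL).tsum_eq
  simp only [noisyASEPGen, siteGen]
  rw [show (∑' x : ℤ, _) = _ from h, ← Finset.sum_add_distrib]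
  simp only [R, L, add_sub_cancel_right, bondGen]

theorem exists_forall_mem_lt_and_lt (F : Finset ℤ) :
    ∃ a b : ℤ, a ≤ b ∧ ∀ x ∈ F, a < x ∧ x < b := by
  obtain ⟨a, ha⟩ := F.bddBelow
  obtain ⟨b, hb⟩ := F.bddAbove
  refine ⟨min a b - 1, b + 1, by omega, fun x hx => ?_⟩
  have := ha hx
  have := hb hx
  omega

theorem sum_Ico_int_sub (G : ℤ → ℝ) {a b : ℤ} (hab : a ≤ b) :
    ∑ x ∈ Finset.Ico a b, (G (x + 1) - G x) = G b - G a := by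
  induction b, hab using Int.leInduction with
  | base => simp
  | succ b hab ih =>
    rw [← Finset.insert_Ico_right_eq_Ico_add_one hab, Finset.sum_insert (by simp), ih]
    ring

namespace IsProductWith

variable {ν : Measure (ℤ → Bool)} [IsProbabilityMeasure ν] {r : ℤ → ℝ}

theorem integral_siteGen (hν : IsProductWith ν r) {β δ : ℝ} {z : ℤ}
    (hz : r z * δ = (1 - r z) * β) {f : (ℤ → Bool) → ℝ} (hf : IsCylinder f) :
    ∫ η, siteGen β δ z f η ∂ν = 0 := by
  rw [hν.integral_eq_integral_update (hf.siteGen β δ z) z]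
  refine integral_eq_zero_of_ae (Eventually.of_forall fun η => ?_)
  have h₁ : flipSite (Function.update η z true) z = Function.update η z false := by
    funext u
    by_cases hu : u = z <;> simp [flipSite, hu]
  have h₀ : flipSite (Function.update η z false) z = Function.update η z true := by
    funext u
    by_cases hu : u = z <;> simp [flipSite, hu]
  simp only [siteGen, h₁, h₀, Function.update_self, if_true, Bool.false_eq_true, if_false,
    Pi.zero_apply]
  linear_combination
    (f (Function.update η z false) - f (Function.update η z true)) * hz

theorem integral_bondGen (hν : IsProductWith ν r) (p q : ℝ) (x : ℤ) {f : (ℤ → Bool) → ℝ}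
    (hf : IsCylinder f) :
    ∫ η, bondGen p q x f η ∂ν =
      (r x * (1 - r (x + 1)) * p - (1 - r x) * r (x + 1) * q) *
        ∫ η, (f (Function.update (Function.update η (x + 1) true) x false) -
          f (Function.update (Function.update η (x + 1) false) x true)) ∂ν := by
  rw [hν.integral_eq_integral_update_update (hf.bondGen p q x) x (x + 1), ← integral_const_mul]
  congr 1
  funext η
  have hswap : ∀ b b' : Bool,
      swapSites (Function.update (Function.update η (x + 1) b) x b') x (x + 1) =
        Function.update (Function.update η (x + 1) b') x b := by
    intro b b'
    funext u
    by_cases hu : u = x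
    · simp [swapSites, hu]
    · by_cases hu' : u = x + 1 <;> simp [swapSites, hu, hu']
  have hswap' : ∀ b b' : Bool,
      swapSites (Function.update (Function.update η (x + 1) b) x b') (x + 1) x =
        Function.update (Function.update η (x + 1) b') x b := by
    intro b b'
    funext u
    by_cases hu : u = x
    · simp [swapSites, hu]
    · by_cases hu' : u = x + 1 <;> simp [swapSites, hu, hu']
  simp [bondGen, hswap, hswap']
  ring

/-- The integral of `f` against the occupation gradient along the bond `{x, x + 1}`. -/
theorem integral_mul_gradient (ρ : ℝ) (hν : IsProductWith ν fun _ => ρ) (x : ℤ)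
    {f : (ℤ → Bool) → ℝ} (hf : IsCylinder f) :
    ∫ η, f η * ((η (x + 1)).toNat - (η x).toNat : ℝ) ∂ν =
      ρ * (1 - ρ) * ∫ η, (f (Function.update (Function.update η (x + 1) true) x false) -
          f (Function.update (Function.update η (x + 1) false) x true)) ∂ν := by
  rw [hν.integral_eq_integral_update_update (hf.mul (isCylinder_apply_apply
    (fun b b' => (b.toNat - b'.toNat : ℝ)) (x + 1) x)) x (x + 1), ← integral_const_mul]
  congr 1
  funext η
  simp
  ring

theorem integral_mul_occupation (hν : IsProductWith ν r) {f : (ℤ → Bool) → ℝ} {F : Finset ℤ}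
    (hF : ∀ η η' : ℤ → Bool, (∀ x ∈ F, η x = η' x) → f η = f η') {x : ℤ} (hx : x ∉ F) :
    ∫ η, f η * ((η x).toNat : ℝ) ∂ν = r x * ∫ η, f η ∂ν := by
  rw [hν.integral_eq_integral_update (IsCylinder.mul ⟨F, hF⟩
    (isCylinder_apply (fun b => (b.toNat : ℝ)) x)) x, ← integral_const_mul]
  congr 1
  funext η
  have h : f (Function.update η x true) = f η :=
    hF _ _ fun u hu => Function.update_of_ne (ne_of_mem_of_not_mem hu hx) _ _
  simp [h]

theorem integral_noisyASEPGen (hν : IsProductWith ν r) (p q β δ : ℝ) (z : ℤ)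
    (hz : r z * δ = (1 - r z) * β) {f : (ℤ → Bool) → ℝ} {F : Finset ℤ}
    (hF : ∀ η η' : ℤ → Bool, (∀ x ∈ F, η x = η' x) → f η = f η') {a b : ℤ}
    (hab : ∀ x ∈ F, a < x ∧ x < b) :
    ∫ η, noisyASEPGen p q β δ z f η ∂ν =
      ∑ x ∈ Finset.Ico a b, ∫ η, bondGen p q x f η ∂ν := by
  have hf : IsCylinder f := ⟨F, hF⟩
  have hbond : ∀ x ∈ Finset.Ico a b, Integrable (bondGen p q x f) ν :=
    fun x _ => (hf.bondGen p q x).integrable ν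
  simp only [noisyASEPGen_eq_sum p q β δ z hF hab]
  rw [integral_add (integrable_finsetSum _ hbond) ((hf.siteGen β δ z).integrable ν),
    hν.integral_siteGen hz hf, add_zero, integral_finsetSum _ hbond]

/-- Detailed balance along every bond and at the birth-death site gives invariance. -/
theorem isInvariant_of_detailedBalance (hν : IsProductWith ν r) {p q β δ : ℝ} {z : ℤ}
    (hz : r z * δ = (1 - r z) * β)
    (hr : ∀ x, r x * (1 - r (x + 1)) * p = (1 - r x) * r (x + 1) * q) :
    IsInvariantForNoisyASEP p q β δ z ν := by
  rintro f ⟨F, hF⟩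
  obtain ⟨a, b, -, hab⟩ := exists_forall_mem_lt_and_lt F
  rw [hν.integral_noisyASEPGen p q β δ z hz hF hab]
  refine Finset.sum_eq_zero fun x _ => ?_
  rw [hν.integral_bondGen p q x ⟨F, hF⟩, hr x, sub_self, zero_mul]

theorem isInvariant_of_const {ρ : ℝ} (hν : IsProductWith ν fun _ => ρ) {p q β δ : ℝ} {z : ℤ}
    (hz : ρ * δ = (1 - ρ) * β) :
    IsInvariantForNoisyASEP p q β δ z ν := by
  rintro f ⟨F, hF⟩
  obtain ⟨a, b, hle, hab⟩ := exists_forall_mem_lt_and_lt F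
  have hf : IsCylinder f := ⟨F, hF⟩
  have hbond : ∀ x, ∫ η, bondGen p q x f η ∂ν = (p - q) *
      (∫ η, f η * ((η (x + 1)).toNat : ℝ) ∂ν - ∫ η, f η * ((η x).toNat : ℝ) ∂ν) := by
    intro x
    have hint : ∀ y, Integrable (fun η => f η * ((η y).toNat : ℝ)) ν := fun y =>
      (hf.mul (isCylinder_apply (fun b => (b.toNat : ℝ)) y)).integrable ν
    rw [← integral_sub (hint _) (hint _), hν.integral_bondGen p q x hf]
    simp only [← mul_sub]
    rw [integral_mul_gradient ρ hν x hf]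
    ring
  rw [hν.integral_noisyASEPGen p q β δ z hz hF hab]
  simp only [hbond]
  rw [← Finset.mul_sum, sum_Ico_int_sub (fun x => ∫ η, f η * ((η x).toNat : ℝ) ∂ν) hle,
    hν.integral_mul_occupation hF fun h => lt_irrefl _ (hab _ h).2,
    hν.integral_mul_occupation hF fun h => lt_irrefl _ (hab _ h).1, sub_self, mul_zero]

end IsProductWith

/-- Nonergodicity of the noisy ASEP with a single birth-death site: both the product
measure `ν^c` with geometric density profile `c π(x)/(1 + c π(x))`, `π(x) = (p/q)^x`,
and the homogeneous product measure `ν_ρ` with `ρ = β/(β+δ)` are invariant; they are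
distinct, so the process has two distinct invariant measures and is not ergodic. -/
theorem noisyASEP_not_ergodic
    (p : ℝ) (hp : 1 / 2 < p) (hp1 : p < 1) (q : ℝ) (hq : q = 1 - p)
    (β δ : ℝ) (hβ : 0 < β) (hδ : 0 < δ) (z : ℤ)
    (π : ℤ → ℝ) (hπ : ∀ x : ℤ, π x = (p / q) ^ x)
    (c : ℝ) (hc : 0 < c) (hcz : c * π z / (1 + c * π z) = β / (β + δ))
    (ν νρ : Measure (ℤ → Bool))
    (hνprob : IsProbabilityMeasure ν) (hνρprob : IsProbabilityMeasure νρ)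
    (hν : IsProductWith ν (fun x => c * π x / (1 + c * π x)))
    (hνρ : IsProductWith νρ (fun _ => β / (β + δ))) :
    IsInvariantForNoisyASEP p q β δ z ν ∧
    IsInvariantForNoisyASEP p q β δ z νρ ∧
    ν ≠ νρ ∧
    ¬ (∀ μ₁ μ₂ : Measure (ℤ → Bool),
        IsProbabilityMeasure μ₁ → IsProbabilityMeasure μ₂ →
        IsInvariantForNoisyASEP p q β δ z μ₁ → IsInvariantForNoisyASEP p q β δ z μ₂ →
        μ₁ = μ₂) := by
  have hq0 : 0 < q := by linarith
  have hp0 : 0 < p := by linarith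
  have hπ0 : ∀ x, 0 < c * π x := fun x => by
    rw [hπ]
    exact mul_pos hc (zpow_pos (div_pos hp0 hq0) x)
  have hπ1 : ∀ x, π (x + 1) * q = π x * p := fun x => by
    rw [hπ, hπ, zpow_add_one₀ (div_pos hp0 hq0).ne']
    field_simp
  have hρ : β / (β + δ) * δ = (1 - β / (β + δ)) * β := by
    field_simp
    ring
  have hinv : IsInvariantForNoisyASEP p q β δ z ν := by
    refine hν.isInvariant_of_detailedBalance (by simpa only [hcz] using hρ) fun x => ?_
    have h₀ := hπ0 x
    have h₁ := hπ0 (x + 1)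
    have h₀' : 1 + c * π x ≠ 0 := by positivity
    have h₁' : 1 + c * π (x + 1) ≠ 0 := by positivity
    field_simp
    linear_combination -hπ1 x
  have hinvρ : IsInvariantForNoisyASEP p q β δ z νρ := hνρ.isInvariant_of_const hρ
  have hne : ν ≠ νρ := by
    rintro rfl
    have h := congrFun (hν.profile_eq hνρ) (z + 1)
    simp only [← hcz] at h
    have h₀ := hπ0 z
    have h₁ := hπ0 (z + 1)
    rw [div_eq_div_iff (by positivity) (by positivity)] at h
    have h₂ : c * π (z + 1) = c * π z := by linear_combination h
    have h₃ : c * π z * (p - q) = 0 := by linear_combination (-c) * hπ1 z + q * h₂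
    rcases mul_eq_zero.1 h₃ with h₄ | h₄ <;> linarith
  exact ⟨hinv, hinvρ, hne, fun h => hne (h ν νρ hνprob hνρprob hinv hinvρ)⟩
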